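/- In the coordinate transport setting, let T be the (0,1)-tensor with components T_i = Φ_i = ∂_iΦ. Then the weighted tensor Laplacian of T satisfies, for every x ∈ Ω and every index i: (LT)_i = ½ Σ_{k,m} (V_{ik} − Ŵ_{ik}) Φ^{km} Φ_m + ¼ Σ_{k,m} g_{ik} Φ^{km} Φ_m − Σ_m W^m Φ_{mi}. -/

import Mathlib

noncomputable section
open scoped BigOperators
open Filter MeasureTheory

/-- Partial derivative `∂_i f`. -/
def pd {n : ℕ} (f : (Fin n → ℝ) → ℝ) (i : Fin n) : (Fin n → ℝ) → ℝ :=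
  fun x => fderiv ℝ f x (Pi.single i 1)

/-- Second partial derivative `f_{ij}`. -/
def pd2 {n : ℕ} (f : (Fin n → ℝ) → ℝ) (i j : Fin n) : (Fin n → ℝ) → ℝ :=
  pd (pd f i) j

/-- Third partial derivative `f_{ijk}`. -/
def pd3 {n : ℕ} (f : (Fin n → ℝ) → ℝ) (i j k : Fin n) : (Fin n → ℝ) → ℝ :=
  pd (pd2 f i j) k

/-- Fourth partial derivative `f_{ijkl}`. -/
def pd4 {n : ℕ} (f : (Fin n → ℝ) → ℝ) (i j k l : Fin n) : (Fin n → ℝ) → ℝ :=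
  pd (pd3 f i j k) l

/-- Fifth partial derivative. -/
def pd5 {n : ℕ} (f : (Fin n → ℝ) → ℝ) (i j k l m : Fin n) : (Fin n → ℝ) → ℝ :=
  pd (pd4 f i j k l) m

/-- The Hessian matrix `D²Φ(x)`, with entries `Φ_{ij}(x)`. -/
def hess {n : ℕ} (Φ : (Fin n → ℝ) → ℝ) (x : Fin n → ℝ) : Matrix (Fin n) (Fin n) ℝ :=
  Matrix.of fun i j => pd2 Φ i j x

/-- The inverse Hessian matrix, with entries `Φ^{ij}(x)`. -/
def ihess {n : ℕ} (Φ : (Fin n → ℝ) → ℝ) (x : Fin n → ℝ) : Matrix (Fin n) (Fin n) ℝ :=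
  (hess Φ x)⁻¹

/-- The gradient `∇Φ(x)`. -/
def grad {n : ℕ} (Φ : (Fin n → ℝ) → ℝ) (x : Fin n → ℝ) : Fin n → ℝ :=
  fun i => pd Φ i x

/-- The Calabi tensor `g_{ij} = Σ Φ_{iab} Φ_{jcd} Φ^{ac} Φ^{bd}`. -/
def calabi {n : ℕ} (Φ : (Fin n → ℝ) → ℝ) (i j : Fin n) (x : Fin n → ℝ) : ℝ :=
  ∑ a, ∑ b, ∑ c, ∑ d,
    pd3 Φ i a b x * pd3 Φ j c d x * ihess Φ x a c * ihess Φ x b d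

/-- `W^i := (∂_i W)(∇Φ)`. -/
def Wop {n : ℕ} (Φ W : (Fin n → ℝ) → ℝ) (i : Fin n) (x : Fin n → ℝ) : ℝ :=
  pd W i (grad Φ x)

/-- `Ŵ_{ij} := Σ_{a,b} W^{ab} Φ_{ai} Φ_{bj}` where `W^{ab} = (∂²_{ab}W)(∇Φ)`. -/
def What2 {n : ℕ} (Φ W : (Fin n → ℝ) → ℝ) (i j : Fin n) (x : Fin n → ℝ) : ℝ :=
  ∑ a, ∑ b, pd2 W a b (grad Φ x) * pd2 Φ a i x * pd2 Φ b j x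

/-- `Ŵ_{ijk} := Σ_{a,b,c} W^{abc} Φ_{ai} Φ_{bj} Φ_{ck}` where `W^{abc} = (∂³_{abc}W)(∇Φ)`. -/
def What3 {n : ℕ} (Φ W : (Fin n → ℝ) → ℝ) (i j k : Fin n) (x : Fin n → ℝ) : ℝ :=
  ∑ a, ∑ b, ∑ c, pd3 W a b c (grad Φ x) * pd2 Φ a i x * pd2 Φ b j x * pd2 Φ c k x

/-- Christoffel symbols `Γ^k_{pq} = ½ Σ_m Φ^{km} Φ_{mpq}` of the Hessian metric. -/
def Γh {n : ℕ} (Φ : (Fin n → ℝ) → ℝ) (k p q : Fin n) (x : Fin n → ℝ) : ℝ :=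
  (1/2) * ∑ m, ihess Φ x k m * pd3 Φ m p q x

/-- Covariant derivative of a (0,1)-tensor: `(∇T)_{p i}`. -/
def covD1 {n : ℕ} (Φ : (Fin n → ℝ) → ℝ) (T : Fin n → (Fin n → ℝ) → ℝ)
    (p i : Fin n) (x : Fin n → ℝ) : ℝ :=
  pd (T i) p x - ∑ m, Γh Φ m p i x * T m x

/-- Covariant derivative of a (0,2)-tensor: `(∇T)_{p i j}`. -/
def covD2 {n : ℕ} (Φ : (Fin n → ℝ) → ℝ) (T : Fin n → Fin n → (Fin n → ℝ) → ℝ)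
    (p i j : Fin n) (x : Fin n → ℝ) : ℝ :=
  pd (T i j) p x - ∑ m, Γh Φ m p i x * T m j x - ∑ m, Γh Φ m p j x * T i m x

/-- Covariant derivative of a (0,3)-tensor: `(∇T)_{p i j k}`. -/
def covD3 {n : ℕ} (Φ : (Fin n → ℝ) → ℝ) (T : Fin n → Fin n → Fin n → (Fin n → ℝ) → ℝ)
    (p i j k : Fin n) (x : Fin n → ℝ) : ℝ :=
  pd (T i j k) p x - ∑ m, Γh Φ m p i x * T m j k x - ∑ m, Γh Φ m p j x * T i m k x
    - ∑ m, Γh Φ m p k x * T i j m x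

/-- Covariant derivative of a (0,4)-tensor: `(∇T)_{p i j k l}`. -/
def covD4 {n : ℕ} (Φ : (Fin n → ℝ) → ℝ)
    (T : Fin n → Fin n → Fin n → Fin n → (Fin n → ℝ) → ℝ)
    (p i j k l : Fin n) (x : Fin n → ℝ) : ℝ :=
  pd (T i j k l) p x - ∑ m, Γh Φ m p i x * T m j k l x - ∑ m, Γh Φ m p j x * T i m k l x
    - ∑ m, Γh Φ m p k x * T i j m l x - ∑ m, Γh Φ m p l x * T i j k m x

/-- Weighted tensor Laplacian of a (0,1)-tensor:
`(LT)_i = Σ Φ^{pq}(∇∇T)_{pq i} − ½ Σ_p (Σ_m Φ^{pm} V_m + W^p)(∇T)_{p i}`. -/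
def LT1 {n : ℕ} (Φ V W : (Fin n → ℝ) → ℝ) (T : Fin n → (Fin n → ℝ) → ℝ)
    (i : Fin n) (x : Fin n → ℝ) : ℝ :=
  (∑ p, ∑ q, ihess Φ x p q * covD2 Φ (covD1 Φ T) p q i x)
    - (1/2) * ∑ p, ((∑ m, ihess Φ x p m * pd V m x) + Wop Φ W p x) * covD1 Φ T p i x

/-- Weighted tensor Laplacian of a (0,2)-tensor. -/
def LT2 {n : ℕ} (Φ V W : (Fin n → ℝ) → ℝ) (T : Fin n → Fin n → (Fin n → ℝ) → ℝ)
    (i j : Fin n) (x : Fin n → ℝ) : ℝ :=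
  (∑ p, ∑ q, ihess Φ x p q * covD3 Φ (covD2 Φ T) p q i j x)
    - (1/2) * ∑ p, ((∑ m, ihess Φ x p m * pd V m x) + Wop Φ W p x) * covD2 Φ T p i j x

/-- Weighted tensor Laplacian of a (0,3)-tensor. -/
def LT3 {n : ℕ} (Φ V W : (Fin n → ℝ) → ℝ) (T : Fin n → Fin n → Fin n → (Fin n → ℝ) → ℝ)
    (i j k : Fin n) (x : Fin n → ℝ) : ℝ :=
  (∑ p, ∑ q, ihess Φ x p q * covD4 Φ (covD3 Φ T) p q i j k x)
    - (1/2) * ∑ p, ((∑ m, ihess Φ x p m * pd V m x) + Wop Φ W p x) * covD3 Φ T p i j k x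

/-- `N_{piab} := Φ_{piab} − ½ Σ_{k,m} Φ^{km}(Φ_{mpi}Φ_{kab} + Φ_{mpa}Φ_{kib} + Φ_{mpb}Φ_{kia})`. -/
def Ncal {n : ℕ} (Φ : (Fin n → ℝ) → ℝ) (p i a b : Fin n) (x : Fin n → ℝ) : ℝ :=
  pd4 Φ p i a b x - (1/2) * ∑ k, ∑ m, ihess Φ x k m *
    (pd3 Φ m p i x * pd3 Φ k a b x + pd3 Φ m p a x * pd3 Φ k i b x
      + pd3 Φ m p b x * pd3 Φ k i a x)

/-- Riemann curvature `R_{ikjl} := ¼ Σ_{a,m} Φ^{am}(Φ_{ila}Φ_{mkj} − Φ_{ija}Φ_{mkl})`. -/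
def Rcal {n : ℕ} (Φ : (Fin n → ℝ) → ℝ) (i k j l : Fin n) (x : Fin n → ℝ) : ℝ :=
  (1/4) * ∑ a, ∑ m, ihess Φ x a m *
    (pd3 Φ i l a x * pd3 Φ m k j x - pd3 Φ i j a x * pd3 Φ m k l x)

/-- The `h`-norm of a quadratic form `Q` at `x`:
`‖Q‖_h(x) = sup { Σ Q_{ij} v_i v_j : Σ Φ_{ij}(x) v_i v_j = 1 }`. -/
def hnorm {n : ℕ} (Φ : (Fin n → ℝ) → ℝ) (Q : Fin n → Fin n → ℝ) (x : Fin n → ℝ) : ℝ :=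
  sSup {r | ∃ v : Fin n → ℝ,
    (∑ i, ∑ j, pd2 Φ i j x * v i * v j) = 1 ∧ r = ∑ i, ∑ j, Q i j * v i * v j}

/-- The matrix `A(x)` with entries `V_{ab} + Ŵ_{ab}`. -/
def Amat {n : ℕ} (Φ V W : (Fin n → ℝ) → ℝ) (x : Fin n → ℝ) : Matrix (Fin n) (Fin n) ℝ :=
  Matrix.of fun a b => pd2 V a b x + What2 Φ W a b x

/-- The matrix `S_i(x)` with entries `V_{iab} − Ŵ_{iab}`. -/
def Smat {n : ℕ} (Φ V W : (Fin n → ℝ) → ℝ) (i : Fin n) (x : Fin n → ℝ) :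
    Matrix (Fin n) (Fin n) ℝ :=
  Matrix.of fun a b => pd3 V i a b x - What3 Φ W i a b x

/-- `H_{ij}(x) := Tr[A(x)⁻¹ · S_i(x) · (D²Φ(x))⁻¹ · S_j(x)]`. -/
def Hten {n : ℕ} (Φ V W : (Fin n → ℝ) → ℝ) (i j : Fin n) (x : Fin n → ℝ) : ℝ :=
  ((Amat Φ V W x)⁻¹ * Smat Φ V W i x * (hess Φ x)⁻¹ * Smat Φ V W j x).trace

/-- Euclidean operator norm of a matrix. -/
def eOpNorm {n : ℕ} (M : Matrix (Fin n) (Fin n) ℝ) : ℝ :=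
  ‖LinearMap.toContinuousLinearMap (Matrix.toEuclideanLin M)‖

/-- Directional derivative of the Hessian: the matrix `∂_e D²F(x)`. -/
def dirHess {n : ℕ} (F : (Fin n → ℝ) → ℝ) (e : Fin n → ℝ) (x : Fin n → ℝ) :
    Matrix (Fin n) (Fin n) ℝ :=
  Matrix.of fun i j => ∑ k, e k * pd3 F k i j x

/-- The quadratic form `⟨Qy, y⟩`. -/
def qform {n : ℕ} (Q : Matrix (Fin n) (Fin n) ℝ) (y : Fin n → ℝ) : ℝ :=
  ∑ i, ∑ j, Q i j * y j * y i

open scoped Topology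

section PartialDerivatives

variable {n : ℕ} {Ω : Set (Fin n → ℝ)} {f g : (Fin n → ℝ) → ℝ} {x : Fin n → ℝ}

theorem pd_congr (h : f =ᶠ[𝓝 x] g) (i : Fin n) : pd f i x = pd g i x := by
  simp only [pd, h.fderiv_eq]

theorem pd_congr_on (hΩ : IsOpen Ω) (h : ∀ y ∈ Ω, f y = g y) (hx : x ∈ Ω) (i : Fin n) :
    pd f i x = pd g i x :=
  pd_congr (Filter.eventually_of_mem (hΩ.mem_nhds hx) h) i

theorem pd_sub (hf : DifferentiableAt ℝ f x) (hg : DifferentiableAt ℝ g x) (i : Fin n) :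
    pd (fun y => f y - g y) i x = pd f i x - pd g i x := by
  simp [pd, fderiv_fun_sub hf hg]

theorem pd_mul (hf : DifferentiableAt ℝ f x) (hg : DifferentiableAt ℝ g x) (i : Fin n) :
    pd (fun y => f y * g y) i x = pd f i x * g x + f x * pd g i x := by
  simp [pd, fderiv_fun_mul hf hg]
  ring

theorem pd_const_mul (hf : DifferentiableAt ℝ f x) (c : ℝ) (i : Fin n) :
    pd (fun y => c * f y) i x = c * pd f i x := by
  simp [pd, fderiv_const_mul hf c]

theorem pd_const (c : ℝ) (i : Fin n) : pd (fun _ => c) i x = 0 := by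
  simp [pd]

theorem pd_sum {ι : Type*} (s : Finset ι) {F : ι → (Fin n → ℝ) → ℝ}
    (hF : ∀ j ∈ s, DifferentiableAt ℝ (F j) x) (i : Fin n) :
    pd (fun y => ∑ j ∈ s, F j y) i x = ∑ j ∈ s, pd (F j) i x := by
  simp [pd, fderiv_fun_sum hF]

theorem pd_log (hf : DifferentiableAt ℝ f x) (h0 : f x ≠ 0) (i : Fin n) :
    pd (fun y => Real.log (f y)) i x = (f x)⁻¹ * pd f i x := by
  simp [pd, fderiv.log hf h0]

theorem ContDiffOn.pd {k m : WithTop ℕ∞} (hf : ContDiffOn ℝ k f Ω) (hΩ : IsOpen Ω)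
    (hmk : m + 1 ≤ k) (i : Fin n) : ContDiffOn ℝ m (pd f i) Ω :=
  (hf.fderiv_of_isOpen hΩ hmk).clm_apply contDiffOn_const

theorem pd2_comm (hf : ContDiffOn ℝ 2 f Ω) (hΩ : IsOpen Ω) (hx : x ∈ Ω) (i j : Fin n) :
    pd2 f i j x = pd2 f j i x := by
  have hfx : ContDiffAt ℝ 2 f x := hf.contDiffAt (hΩ.mem_nhds hx)
  have hd : DifferentiableAt ℝ (fderiv ℝ f) x :=
    (hfx.fderiv_right (m := 1) (by norm_num)).differentiableAt (by norm_num)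
  have key : ∀ i j : Fin n, pd2 f i j x
      = fderiv ℝ (fderiv ℝ f) x (Pi.single j 1) (Pi.single i 1) := by
    intro i j
    have := hd.hasFDerivAt.clm_apply (hasFDerivAt_const (Pi.single i (1 : ℝ)) x)
    change fderiv ℝ (fun y => fderiv ℝ f y (Pi.single i 1)) x _ = _
    rw [this.fderiv]
    simp
  rw [key, key, (hfx.isSymmSndFDerivAt (by simp)).eq]

/-- The chain rule for a composition with a vector-valued map given by its components. -/
theorem pd_comp {G : Fin n → (Fin n → ℝ) → ℝ}
    (hf : DifferentiableAt ℝ f (fun a => G a x))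
    (hG : ∀ a, DifferentiableAt ℝ (G a) x) (i : Fin n) :
    pd (fun y => f (fun a => G a y)) i x = ∑ a, pd f a (fun a => G a x) * pd (G a) i x := by
  have h := hf.hasFDerivAt.comp x (hasFDerivAt_pi.2 fun a => (hG a).hasFDerivAt)
  have h' : pd (fun y => f (fun a => G a y)) i x
      = fderiv ℝ f (fun a => G a x) (fun a => pd (G a) i x) := by
    simp only [pd]
    rw [show (fun y => f (fun a => G a y)) = f ∘ fun y a => G a y from rfl, h.fderiv]
    rfl
  refine h'.trans ((LinearMap.pi_apply_eq_sum_univ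
    (fderiv ℝ f (fun a => G a x)).toLinearMap _).trans ?_)
  refine Finset.sum_congr rfl fun a _ => ?_
  simp only [pd, smul_eq_mul, mul_comm, ContinuousLinearMap.coe_coe]
  congr 2
  ext j
  simp [Pi.single_apply, eq_comm]

end PartialDerivatives

section MatrixDerivatives

variable {n : ℕ} {M : (Fin n → ℝ) → Matrix (Fin n) (Fin n) ℝ} {x : Fin n → ℝ}

theorem differentiableAt_det (hM : ∀ a b, DifferentiableAt ℝ (fun y => M y a b) x) :
    DifferentiableAt ℝ (fun y => (M y).det) x := by
  simp only [Matrix.det_apply]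
  fun_prop

/-- Jacobi's formula. -/
theorem pd_det (hM : ∀ a b, DifferentiableAt ℝ (fun y => M y a b) x) (i : Fin n) :
    pd (fun y => (M y).det) i x
      = ∑ p, ∑ q, (M x).adjugate q p * pd (fun y => M y p q) i x := by
  let D : ContinuousMultilinearMap ℝ (fun _ : Fin n => Fin n → ℝ) ℝ :=
    ⟨(Matrix.detRowAlternating : (Fin n → ℝ) [⋀^Fin n]→ₗ[ℝ] ℝ).toMultilinearMap,
      Continuous.matrix_det continuous_id⟩
  have h := (D.hasFDerivAt (M x)).comp x
    (hasFDerivAt_pi.2 fun a => hasFDerivAt_pi.2 fun b => (hM a b).hasFDerivAt)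
  have h' : pd (fun y => (M y).det) i x
      = ∑ p, ((M x).updateRow p (fun q => pd (fun y => M y p q) i x)).det := by
    simp only [pd]
    rw [show (fun y => (M y).det) = D ∘ fun y a b => M y a b from rfl, h.fderiv]
    exact ContinuousMultilinearMap.linearDeriv_apply ..
  rw [h']
  refine Finset.sum_congr rfl fun p _ => ?_
  rw [← Matrix.cramer_transpose_apply, Matrix.cramer_eq_adjugate_mulVec,
    ← Matrix.adjugate_transpose]
  rfl

theorem differentiableAt_matrix_inv (hM : ∀ a b, DifferentiableAt ℝ (fun y => M y a b) x)
    (h0 : (M x).det ≠ 0) (a b : Fin n) : DifferentiableAt ℝ (fun y => (M y)⁻¹ a b) x := by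
  have hadj : DifferentiableAt ℝ (fun y => (M y).adjugate a b) x := by
    simp only [Matrix.adjugate_apply]
    refine differentiableAt_det fun c d => ?_
    by_cases h : c = b
    · subst h
      simp
    · simpa [Matrix.updateRow_ne h] using hM c d
  simp only [Matrix.inv_def, Ring.inverse_eq_inv', Matrix.smul_apply, smul_eq_mul]
  exact ((differentiableAt_det hM).inv h0).mul hadj

theorem pd_matrix_inv (hM : ∀ a b, DifferentiableAt ℝ (fun y => M y a b) x)
    (h0 : (M x).det ≠ 0) (i a b : Fin n) :
    pd (fun y => (M y)⁻¹ a b) i x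
      = -((M x)⁻¹ * Matrix.of (fun c d => pd (fun y => M y c d) i x) * (M x)⁻¹) a b := by
  have hP := differentiableAt_matrix_inv hM h0
  have hev : ∀ᶠ y in 𝓝 x, (M y).det ≠ 0 := (differentiableAt_det hM).continuousAt.eventually_ne h0
  set dP : Matrix (Fin n) (Fin n) ℝ := Matrix.of fun c d => pd (fun y => (M y)⁻¹ c d) i x with hdP
  set dM : Matrix (Fin n) (Fin n) ℝ := Matrix.of fun c d => pd (fun y => M y c d) i x with hdM
  have hsum : dP * M x + (M x)⁻¹ * dM = 0 := by
    ext c d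
    have h1 : pd (fun y => ∑ e, (M y)⁻¹ c e * M y e d) i x = 0 := by
      rw [pd_congr (g := fun _ => (1 : Matrix (Fin n) (Fin n) ℝ) c d), pd_const]
      filter_upwards [hev] with y hy
      rw [← Matrix.nonsing_inv_mul (M y) (isUnit_iff_ne_zero.2 hy), Matrix.mul_apply]
    rw [pd_sum _ fun e _ => (hP c e).fun_mul (hM e d)] at h1
    simp only [pd_mul (hP c _) (hM _ d), Finset.sum_add_distrib] at h1
    simpa [Matrix.mul_apply, hdP, hdM] using h1
  have hu : M x * (M x)⁻¹ = 1 := Matrix.mul_nonsing_inv _ (isUnit_iff_ne_zero.2 h0)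
  have hmat : dP = -((M x)⁻¹ * dM * (M x)⁻¹) := by
    calc dP = dP * M x * (M x)⁻¹ := by rw [Matrix.mul_assoc, hu, Matrix.mul_one]
      _ = -((M x)⁻¹ * dM) * (M x)⁻¹ := by rw [eq_neg_of_add_eq_zero_left hsum]
      _ = _ := by rw [Matrix.neg_mul]
  exact congr_fun (congr_fun hmat a) b

end MatrixDerivatives

open scoped Matrix

/-- The partial derivative `∂_i D²Φ(x)` of the Hessian matrix, with entries `Φ_{abi}(x)`. -/
def hessDeriv {n : ℕ} (Φ : (Fin n → ℝ) → ℝ) (i : Fin n) (x : Fin n → ℝ) :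
    Matrix (Fin n) (Fin n) ℝ :=
  Matrix.of fun a b => pd3 Φ a b i x

/-- The gradient with raised index, `u^k = Σ_m Φ^{km} Φ_m`. -/
def gradUp {n : ℕ} (Φ : (Fin n → ℝ) → ℝ) (k : Fin n) (x : Fin n → ℝ) : ℝ :=
  ∑ m, ihess Φ x k m * pd Φ m x

/-- The matrix with entries `Σ_k Φ_{abk} u^k`, where `u` is the gradient with raised index. -/
def hessDerivGrad {n : ℕ} (Φ : (Fin n → ℝ) → ℝ) (x : Fin n → ℝ) : Matrix (Fin n) (Fin n) ℝ :=
  Matrix.of fun a b => ∑ k, pd3 Φ a b k x * gradUp Φ k x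

/-- The derivative `Σ_{p,q} Φ^{pq} Φ_{pqi}` of `log det D²Φ`. -/
def logDetDeriv {n : ℕ} (Φ : (Fin n → ℝ) → ℝ) (i : Fin n) (x : Fin n → ℝ) : ℝ :=
  ∑ p, ∑ q, ihess Φ x p q * pd3 Φ p q i x

section HessianMetric

variable {n : ℕ} {Ω : Set (Fin n → ℝ)} {Φ V W : (Fin n → ℝ) → ℝ} {x : Fin n → ℝ}

theorem contDiffOn_pd2 (hΩ : IsOpen Ω) (hΦ : ContDiffOn ℝ 5 Φ Ω) (i j : Fin n) :
    ContDiffOn ℝ 3 (pd2 Φ i j) Ω :=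
  (hΦ.pd (m := 4) hΩ (by norm_num) i).pd hΩ (by norm_num) j

theorem differentiableAt_pd (hΩ : IsOpen Ω) (hΦ : ContDiffOn ℝ 5 Φ Ω) (hx : x ∈ Ω) (i : Fin n) :
    DifferentiableAt ℝ (pd Φ i) x :=
  ((hΦ.pd (m := 4) hΩ (by norm_num) i).contDiffAt (hΩ.mem_nhds hx)).differentiableAt (by norm_num)

theorem differentiableAt_pd2 (hΩ : IsOpen Ω) (hΦ : ContDiffOn ℝ 5 Φ Ω) (hx : x ∈ Ω)
    (i j : Fin n) : DifferentiableAt ℝ (pd2 Φ i j) x :=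
  ((contDiffOn_pd2 hΩ hΦ i j).contDiffAt (hΩ.mem_nhds hx)).differentiableAt (by norm_num)

theorem differentiableAt_pd3 (hΩ : IsOpen Ω) (hΦ : ContDiffOn ℝ 5 Φ Ω) (hx : x ∈ Ω)
    (i j k : Fin n) : DifferentiableAt ℝ (pd3 Φ i j k) x :=
  (((contDiffOn_pd2 hΩ hΦ i j).pd (m := 2) hΩ (by norm_num) k).contDiffAt
    (hΩ.mem_nhds hx)).differentiableAt (by norm_num)

theorem pd2_symm (hΩ : IsOpen Ω) (hΦ : ContDiffOn ℝ 5 Φ Ω) (hx : x ∈ Ω) (i j : Fin n) :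
    pd2 Φ i j x = pd2 Φ j i x :=
  pd2_comm (hΦ.of_le (by norm_num)) hΩ hx i j

theorem pd3_swap_left (hΩ : IsOpen Ω) (hΦ : ContDiffOn ℝ 5 Φ Ω) (hx : x ∈ Ω) (i j k : Fin n) :
    pd3 Φ i j k x = pd3 Φ j i k x :=
  pd_congr_on hΩ (fun _ hy => pd2_symm hΩ hΦ hy i j) hx k

theorem pd3_swap_right (hΩ : IsOpen Ω) (hΦ : ContDiffOn ℝ 5 Φ Ω) (hx : x ∈ Ω) (i j k : Fin n) :
    pd3 Φ i j k x = pd3 Φ i k j x :=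
  pd2_comm (hΦ.pd hΩ (by norm_num) i) hΩ hx j k

theorem pd4_rotate (hΩ : IsOpen Ω) (hΦ : ContDiffOn ℝ 5 Φ Ω) (hx : x ∈ Ω) (q i k p : Fin n) :
    pd4 Φ q i k p x = pd4 Φ p q i k x := by
  have h : pd4 Φ q i k p x = pd4 Φ q i p k x :=
    pd2_comm ((contDiffOn_pd2 hΩ hΦ q i).of_le (by norm_num)) hΩ hx k p
  rw [h]
  refine pd_congr_on hΩ (fun y hy => ?_) hx k
  rw [pd3_swap_right hΩ hΦ hy, pd3_swap_left hΩ hΦ hy]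

theorem ihess_symm (hΩ : IsOpen Ω) (hΦ : ContDiffOn ℝ 5 Φ Ω) (hx : x ∈ Ω) (a b : Fin n) :
    ihess Φ x a b = ihess Φ x b a := by
  have h : (hess Φ x)ᵀ = hess Φ x := Matrix.ext fun i j => pd2_symm hΩ hΦ hx j i
  have h' : (ihess Φ x)ᵀ = ihess Φ x := by rw [ihess, Matrix.transpose_nonsing_inv, h]
  exact congr_fun (congr_fun h' b) a

theorem hessDeriv_symm (hΩ : IsOpen Ω) (hΦ : ContDiffOn ℝ 5 Φ Ω) (hx : x ∈ Ω) (i a b : Fin n) :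
    hessDeriv Φ i x a b = hessDeriv Φ i x b a :=
  pd3_swap_left hΩ hΦ hx a b i

theorem differentiableAt_ihess (hΩ : IsOpen Ω) (hΦ : ContDiffOn ℝ 5 Φ Ω)
    (hpos : (hess Φ x).PosDef) (hx : x ∈ Ω) (a b : Fin n) :
    DifferentiableAt ℝ (fun y => ihess Φ y a b) x :=
  differentiableAt_matrix_inv (fun c d => differentiableAt_pd2 hΩ hΦ hx c d) hpos.det_pos.ne' a b

theorem pd_ihess (hΩ : IsOpen Ω) (hΦ : ContDiffOn ℝ 5 Φ Ω)
    (hpos : (hess Φ x).PosDef) (hx : x ∈ Ω) (i a b : Fin n) :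
    pd (fun y => ihess Φ y a b) i x = -(ihess Φ x * hessDeriv Φ i x * ihess Φ x) a b :=
  pd_matrix_inv (fun c d => differentiableAt_pd2 hΩ hΦ hx c d) hpos.det_pos.ne' i a b

theorem ihess_mul_hess (hpos : (hess Φ x).PosDef) : ihess Φ x * hess Φ x = 1 :=
  Matrix.nonsing_inv_mul _ (isUnit_iff_ne_zero.2 hpos.det_pos.ne')

theorem pd_log_det_hess (hΩ : IsOpen Ω) (hΦ : ContDiffOn ℝ 5 Φ Ω)
    (hpos : (hess Φ x).PosDef) (hx : x ∈ Ω) (i : Fin n) :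
    pd (fun y => Real.log (hess Φ y).det) i x = logDetDeriv Φ i x := by
  have hd : ∀ c d, DifferentiableAt ℝ (fun y => hess Φ y c d) x :=
    fun c d => differentiableAt_pd2 hΩ hΦ hx c d
  rw [pd_log (differentiableAt_det hd) hpos.det_pos.ne', pd_det hd, Finset.mul_sum]
  refine Finset.sum_congr rfl fun p _ => ?_
  rw [Finset.mul_sum]
  refine Finset.sum_congr rfl fun q _ => ?_
  rw [ihess_symm hΩ hΦ hx p q, ← mul_assoc]
  simp only [ihess, Matrix.inv_def, Ring.inverse_eq_inv', Matrix.smul_apply, smul_eq_mul]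
  rfl

/-- The logarithmic derivative of the Monge–Ampère equation. -/
theorem pd_potential (hΩ : IsOpen Ω) (hΦ : ContDiffOn ℝ 5 Φ Ω)
    (hpos : ∀ x ∈ Ω, (hess Φ x).PosDef) (hW : ContDiff ℝ 3 W)
    (hMA : ∀ x ∈ Ω, Real.exp (-V x) = Real.exp (-W (grad Φ x)) * (hess Φ x).det)
    (hx : x ∈ Ω) (i : Fin n) :
    pd V i x = ∑ a, Wop Φ W a x * pd2 Φ a i x - logDetDeriv Φ i x := by
  have hV : ∀ y ∈ Ω, V y = W (grad Φ y) - Real.log (hess Φ y).det := by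
    intro y hy
    have h := congr_arg Real.log (hMA y hy)
    rw [Real.log_exp, Real.log_mul (Real.exp_ne_zero _) (hpos y hy).det_pos.ne',
      Real.log_exp] at h
    linarith
  have hWd : Differentiable ℝ W := hW.differentiable (by norm_num)
  have hgrad : DifferentiableAt ℝ (grad Φ) x :=
    differentiableAt_pi.2 fun a => differentiableAt_pd hΩ hΦ hx a
  rw [pd_congr_on hΩ hV hx, pd_sub, pd_log_det_hess hΩ hΦ (hpos x hx) hx]
  · congr 1
    exact pd_comp (hWd _) (fun a => differentiableAt_pd hΩ hΦ hx a) i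
  · exact (hWd _).comp x hgrad
  · exact (differentiableAt_det fun c d => differentiableAt_pd2 hΩ hΦ hx c d).log
      (hpos x hx).det_pos.ne'

theorem pd_logDetDeriv (hΩ : IsOpen Ω) (hΦ : ContDiffOn ℝ 5 Φ Ω)
    (hpos : (hess Φ x).PosDef) (hx : x ∈ Ω) (i k : Fin n) :
    pd (logDetDeriv Φ i) k x
      = ∑ p, ∑ q, ihess Φ x p q * pd4 Φ p q i k x
        - (ihess Φ x * hessDeriv Φ k x * ihess Φ x * hessDeriv Φ i x).trace := by
  have hP := differentiableAt_ihess hΩ hΦ hpos hx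
  have h3 := differentiableAt_pd3 hΩ hΦ hx
  have htr : (ihess Φ x * hessDeriv Φ k x * ihess Φ x * hessDeriv Φ i x).trace
      = ∑ p, ∑ q, (ihess Φ x * hessDeriv Φ k x * ihess Φ x) p q * pd3 Φ p q i x := by
    simp only [Matrix.trace, Matrix.diag_apply]
    refine Finset.sum_congr rfl fun p _ => ?_
    rw [Matrix.mul_apply]
    refine Finset.sum_congr rfl fun q _ => ?_
    rw [hessDeriv_symm hΩ hΦ hx]
    rfl
  have h : pd (logDetDeriv Φ i) k x
      = ∑ p, ∑ q, pd (fun y => ihess Φ y p q * pd3 Φ p q i y) k x := by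
    refine (pd_sum _ (fun p _ => DifferentiableAt.fun_sum
      fun q _ => (hP p q).fun_mul (h3 p q i)) k).trans ?_
    exact Finset.sum_congr rfl fun p _ => pd_sum _ (fun q _ => (hP p q).fun_mul (h3 p q i)) k
  rw [h, htr, ← Finset.sum_sub_distrib]
  refine Finset.sum_congr rfl fun p _ => ?_
  rw [← Finset.sum_sub_distrib]
  refine Finset.sum_congr rfl fun q _ => ?_
  rw [pd_mul (hP p q) (h3 p q i), pd_ihess hΩ hΦ hpos hx, pd4]
  ring

/-- The second derivative of the Monge–Ampère equation. -/
theorem pd2_potential (hΩ : IsOpen Ω) (hΦ : ContDiffOn ℝ 5 Φ Ω)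
    (hpos : ∀ x ∈ Ω, (hess Φ x).PosDef) (hW : ContDiff ℝ 3 W)
    (hMA : ∀ x ∈ Ω, Real.exp (-V x) = Real.exp (-W (grad Φ x)) * (hess Φ x).det)
    (hx : x ∈ Ω) (i k : Fin n) :
    pd2 V i k x = What2 Φ W i k x + ∑ a, Wop Φ W a x * pd3 Φ a i k x
      + (ihess Φ x * hessDeriv Φ k x * ihess Φ x * hessDeriv Φ i x).trace
      - ∑ p, ∑ q, ihess Φ x p q * pd4 Φ p q i k x := by
  have hP := differentiableAt_ihess hΩ hΦ (hpos x hx) hx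
  have hgrad : DifferentiableAt ℝ (grad Φ) x :=
    differentiableAt_pi.2 fun a => differentiableAt_pd hΩ hΦ hx a
  have hWa : ∀ a, Differentiable ℝ (pd W a) := fun a =>
    (contDiffOn_univ.1 ((contDiffOn_univ.2 hW).pd (m := 2) isOpen_univ
      (by norm_num) a)).differentiable (by norm_num)
  have hWop : ∀ a, DifferentiableAt ℝ (Wop Φ W a) x := fun a => ((hWa a) _).comp x hgrad
  have hpdW : ∀ a, pd (Wop Φ W a) k x = ∑ b, pd2 W a b (grad Φ x) * pd2 Φ b k x := fun a =>
    pd_comp (hWa a _) (fun a => differentiableAt_pd hΩ hΦ hx a) k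
  have h2 := differentiableAt_pd2 hΩ hΦ hx
  have h3 := differentiableAt_pd3 hΩ hΦ hx
  have hlog : DifferentiableAt ℝ (logDetDeriv Φ i) x :=
    DifferentiableAt.fun_sum fun p _ => DifferentiableAt.fun_sum
      fun q _ => (hP p q).fun_mul (h3 p q i)
  have hsum : pd (fun y => ∑ a, Wop Φ W a y * pd2 Φ a i y) k x
      = What2 Φ W i k x + ∑ a, Wop Φ W a x * pd3 Φ a i k x := by
    rw [pd_sum _ fun a _ => (hWop a).fun_mul (h2 a i), What2, ← Finset.sum_add_distrib]
    refine Finset.sum_congr rfl fun a _ => ?_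
    rw [pd_mul (hWop a) (h2 a i), hpdW, Finset.sum_mul]
    congr 1
    exact Finset.sum_congr rfl fun b _ => by ring
  rw [pd2, pd_congr_on hΩ (fun y hy => pd_potential hΩ hΦ hpos hW hMA hy i) hx,
    pd_sub (DifferentiableAt.fun_sum fun a _ => (hWop a).fun_mul (h2 a i)) hlog, hsum,
    pd_logDetDeriv hΩ hΦ (hpos x hx) hx]
  ring

theorem covD1_pd_eq (hΩ : IsOpen Ω) (hΦ : ContDiffOn ℝ 5 Φ Ω) (hx : x ∈ Ω) (p i : Fin n) :
    covD1 Φ (fun i => pd Φ i) p i x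
      = pd2 Φ i p x - (1/2) * ∑ k, pd3 Φ p i k x * gradUp Φ k x := by
  simp only [covD1, Γh, gradUp, pd2, mul_assoc, Finset.sum_mul, Finset.mul_sum]
  rw [Finset.sum_comm]
  congr 1
  refine Finset.sum_congr rfl fun k _ => Finset.sum_congr rfl fun m _ => ?_
  rw [ihess_symm hΩ hΦ hx m k, pd3_swap_left hΩ hΦ hx k p i, pd3_swap_right hΩ hΦ hx p k i]
  ring

theorem covD1_pd_eq_sub (hΩ : IsOpen Ω) (hΦ : ContDiffOn ℝ 5 Φ Ω) (hx : x ∈ Ω) (p i : Fin n) :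
    covD1 Φ (fun i => pd Φ i) p i x = (hess Φ x - (1/2 : ℝ) • hessDerivGrad Φ x) p i := by
  rw [covD1_pd_eq hΩ hΦ hx, pd2_symm hΩ hΦ hx]
  rfl

theorem differentiableAt_gradUp (hΩ : IsOpen Ω) (hΦ : ContDiffOn ℝ 5 Φ Ω)
    (hpos : (hess Φ x).PosDef) (hx : x ∈ Ω) (k : Fin n) : DifferentiableAt ℝ (gradUp Φ k) x :=
  DifferentiableAt.fun_sum fun m _ =>
    (differentiableAt_ihess hΩ hΦ hpos hx k m).fun_mul (differentiableAt_pd hΩ hΦ hx m)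

theorem pd_gradUp (hΩ : IsOpen Ω) (hΦ : ContDiffOn ℝ 5 Φ Ω)
    (hpos : (hess Φ x).PosDef) (hx : x ∈ Ω) (k p : Fin n) :
    pd (gradUp Φ k) p x
      = (1 : Matrix (Fin n) (Fin n) ℝ) k p - (ihess Φ x * hessDerivGrad Φ x) k p := by
  have hP := differentiableAt_ihess hΩ hΦ hpos hx
  have h1 := differentiableAt_pd hΩ hΦ hx
  have hu : (fun c => gradUp Φ c x) = ihess Φ x *ᵥ fun m => pd Φ m x := rfl
  have hB : (fun a => hessDerivGrad Φ x a p) = hessDeriv Φ p x *ᵥ fun c => gradUp Φ c x := by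
    funext a
    simp only [hessDerivGrad, hessDeriv, Matrix.of_apply, Matrix.mulVec, dotProduct,
      pd3_swap_right hΩ hΦ hx a p]
  have hPB : (ihess Φ x * hessDerivGrad Φ x) k p
      = ∑ m, (ihess Φ x * hessDeriv Φ p x * ihess Φ x) k m * pd Φ m x := by
    change (ihess Φ x *ᵥ fun a => hessDerivGrad Φ x a p) k
      = ((ihess Φ x * hessDeriv Φ p x * ihess Φ x) *ᵥ fun m => pd Φ m x) k
    rw [hB, hu, Matrix.mulVec_mulVec, Matrix.mulVec_mulVec]
  have h : pd (gradUp Φ k) p x = ∑ m, pd (fun y => ihess Φ y k m * pd Φ m y) p x :=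
    pd_sum _ (fun m _ => (hP k m).fun_mul (h1 m)) p
  rw [h, hPB, ← ihess_mul_hess hpos, Matrix.mul_apply, ← Finset.sum_sub_distrib]
  refine Finset.sum_congr rfl fun m _ => ?_
  rw [pd_mul (hP k m) (h1 m), pd_ihess hΩ hΦ hpos hx]
  simp only [hess, Matrix.of_apply, pd2]
  ring

theorem pd_covD1_pd (hΩ : IsOpen Ω) (hΦ : ContDiffOn ℝ 5 Φ Ω)
    (hpos : (hess Φ x).PosDef) (hx : x ∈ Ω) (p q i : Fin n) :
    pd (covD1 Φ (fun i => pd Φ i) q i) p x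
      = (1/2) * hessDeriv Φ i x q p - (1/2) * ∑ k, pd4 Φ p q i k x * gradUp Φ k x
        + (1/2) * (hessDeriv Φ i x * ihess Φ x * hessDerivGrad Φ x) q p := by
  have h3 := differentiableAt_pd3 hΩ hΦ hx
  have hu := differentiableAt_gradUp hΩ hΦ hpos hx
  have hs : DifferentiableAt ℝ (fun y => ∑ k, pd3 Φ q i k y * gradUp Φ k y) x :=
    DifferentiableAt.fun_sum fun k _ => (h3 q i k).fun_mul (hu k)
  have hA : ∀ k, pd3 Φ q i k x = hessDeriv Φ i x q k := fun k => pd3_swap_right hΩ hΦ hx q i k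
  have hsum : pd (fun y => ∑ k, pd3 Φ q i k y * gradUp Φ k y) p x
      = ∑ k, pd4 Φ p q i k x * gradUp Φ k x + hessDeriv Φ i x q p
        - (hessDeriv Φ i x * ihess Φ x * hessDerivGrad Φ x) q p := by
    rw [pd_sum _ fun k _ => (h3 q i k).fun_mul (hu k)]
    have hterm : ∀ k, pd (fun y => pd3 Φ q i k y * gradUp Φ k y) p x
        = pd4 Φ p q i k x * gradUp Φ k x
          + hessDeriv Φ i x q k * (1 : Matrix (Fin n) (Fin n) ℝ) k p
          - hessDeriv Φ i x q k * (ihess Φ x * hessDerivGrad Φ x) k p := by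
      intro k
      rw [pd_mul (h3 q i k) (hu k), pd_gradUp hΩ hΦ hpos hx, ← pd4_rotate hΩ hΦ hx, hA, pd4]
      ring
    simp only [hterm, Finset.sum_add_distrib, Finset.sum_sub_distrib]
    rw [← Matrix.mul_apply, ← Matrix.mul_apply, Matrix.mul_one, Matrix.mul_assoc]
  rw [pd_congr_on hΩ (fun y hy => covD1_pd_eq hΩ hΦ hy q i) hx,
    pd_sub (differentiableAt_pd2 hΩ hΦ hx i q) (hs.const_mul _), pd_const_mul hs, hsum]
  have : pd (pd2 Φ i q) p x = hessDeriv Φ i x q p :=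
    (pd3_swap_left hΩ hΦ hx i q p).trans (hA p)
  rw [this]
  ring

theorem calabi_eq_trace (hΩ : IsOpen Ω) (hΦ : ContDiffOn ℝ 5 Φ Ω) (hx : x ∈ Ω) (i k : Fin n) :
    calabi Φ i k x = (ihess Φ x * hessDeriv Φ i x * ihess Φ x * hessDeriv Φ k x).trace := by
  have hrot : ∀ i a b, pd3 Φ i a b x = hessDeriv Φ i x a b := fun i a b => by
    rw [pd3_swap_left hΩ hΦ hx, pd3_swap_right hΩ hΦ hx]
    rfl
  rw [Matrix.mul_assoc, Matrix.mul_assoc, Matrix.trace_mul_comm, Matrix.mul_assoc]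
  simp only [Matrix.trace, Matrix.diag_apply, calabi, hrot]
  refine Finset.sum_congr rfl fun a _ => ?_
  rw [Matrix.mul_apply]
  refine Finset.sum_congr rfl fun b _ => ?_
  rw [Matrix.mul_apply, Finset.mul_sum]
  refine Finset.sum_congr rfl fun c _ => ?_
  rw [Matrix.mul_apply, Finset.sum_mul, Finset.mul_sum]
  refine Finset.sum_congr rfl fun d _ => ?_
  rw [hessDeriv_symm hΩ hΦ hx k c d, ihess_symm hΩ hΦ hx a c]
  ring

theorem hessDerivGrad_eq_sum : hessDerivGrad Φ x = ∑ k, gradUp Φ k x • hessDeriv Φ k x := by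
  ext a b
  simp only [hessDerivGrad, hessDeriv, Matrix.of_apply, Matrix.sum_apply, Matrix.smul_apply,
    smul_eq_mul, mul_comm]

theorem sum_trace_mul_gradUp (M : Matrix (Fin n) (Fin n) ℝ) :
    ∑ k, (M * hessDeriv Φ k x).trace * gradUp Φ k x = (M * hessDerivGrad Φ x).trace := by
  simp only [hessDerivGrad_eq_sum, Finset.mul_sum, Matrix.trace_sum, Matrix.mul_smul,
    Matrix.trace_smul, smul_eq_mul, mul_comm]

theorem sum_ihess_mul_Γh (hΩ : IsOpen Ω) (hΦ : ContDiffOn ℝ 5 Φ Ω) (hx : x ∈ Ω) (m : Fin n) :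
    ∑ p, ∑ q, ihess Φ x p q * Γh Φ m p q x
      = (1/2) * ∑ k, ihess Φ x m k * logDetDeriv Φ k x := by
  simp only [Γh, logDetDeriv, Finset.mul_sum]
  rw [Finset.sum_congr rfl fun p _ => Finset.sum_comm, Finset.sum_comm]
  refine Finset.sum_congr rfl fun k _ => Finset.sum_congr rfl fun p _ =>
    Finset.sum_congr rfl fun q _ => ?_
  rw [pd3_swap_left hΩ hΦ hx k p q, pd3_swap_right hΩ hΦ hx p k q]
  ring

theorem Γh_eq (m p i : Fin n) :
    Γh Φ m p i x = (1/2) * (ihess Φ x * hessDeriv Φ i x) m p := by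
  rw [Matrix.mul_apply]
  rfl

/-- The rough Laplacian of the gradient one-form. -/
theorem sum_ihess_mul_covD2_covD1_pd (hΩ : IsOpen Ω) (hΦ : ContDiffOn ℝ 5 Φ Ω)
    (hpos : (hess Φ x).PosDef) (hx : x ∈ Ω) (i : Fin n) :
    ∑ p, ∑ q, ihess Φ x p q * covD2 Φ (covD1 Φ (fun i => pd Φ i)) p q i x
      = (3/4) * (ihess Φ x * hessDeriv Φ i x * ihess Φ x * hessDerivGrad Φ x).trace
        - (1/2) * ∑ k, (∑ p, ∑ q, ihess Φ x p q * pd4 Φ p q i k x) * gradUp Φ k x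
        - (1/2) * ∑ m, (∑ k, ihess Φ x m k * logDetDeriv Φ k x)
            * covD1 Φ (fun i => pd Φ i) m i x := by
  set P := ihess Φ x with hP
  set A := hessDeriv Φ i x with hA
  set B := hessDerivGrad Φ x with hB
  set S := covD1 Φ (fun i => pd Φ i) with hS
  have hSmat : ∀ q m, S q m x = (hess Φ x - (1/2 : ℝ) • B) q m := covD1_pd_eq_sub hΩ hΦ hx
  have hsum_tr : ∀ M : Matrix (Fin n) (Fin n) ℝ, ∑ p, ∑ q, P p q * M q p = (P * M).trace :=
    fun _ => rfl
  have hquartic : ∑ p, ∑ q, P p q * ∑ k, pd4 Φ p q i k x * gradUp Φ k x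
      = ∑ k, (∑ p, ∑ q, P p q * pd4 Φ p q i k x) * gradUp Φ k x := by
    simp only [Finset.mul_sum, Finset.sum_mul, mul_assoc]
    rw [Finset.sum_congr rfl fun p _ => Finset.sum_comm, Finset.sum_comm]
  have hfirst : ∑ p, ∑ q, P p q * ∑ m, Γh Φ m p q x * S m i x
      = (1/2) * ∑ m, (∑ k, P m k * logDetDeriv Φ k x) * S m i x := by
    have h : ∑ p, ∑ q, P p q * ∑ m, Γh Φ m p q x * S m i x
        = ∑ m, (∑ p, ∑ q, P p q * Γh Φ m p q x) * S m i x := by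
      simp only [Finset.mul_sum, Finset.sum_mul, mul_assoc]
      rw [Finset.sum_congr rfl fun p _ => Finset.sum_comm, Finset.sum_comm]
    rw [h, Finset.mul_sum]
    exact Finset.sum_congr rfl fun m _ => by rw [hP, sum_ihess_mul_Γh hΩ hΦ hx, mul_assoc]
  have hsecond : ∑ p, ∑ q, P p q * ∑ m, Γh Φ m p i x * S q m x
      = (1/2) * (P * A).trace - (1/4) * (P * A * P * B).trace := by
    have h : ∀ p q, ∑ m, Γh Φ m p i x * S q m x
        = ((1/2 : ℝ) • ((hess Φ x - (1/2 : ℝ) • B) * (P * A))) q p := by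
      intro p q
      rw [Matrix.smul_apply, Matrix.mul_apply, smul_eq_mul, Finset.mul_sum]
      exact Finset.sum_congr rfl fun m _ => by rw [Γh_eq, hSmat]; ring
    have hPH : P * (hess Φ x * (P * A)) = P * A := by
      rw [← Matrix.mul_assoc, ihess_mul_hess hpos, Matrix.one_mul]
    have hcyc : (P * (B * (P * A))).trace = (P * A * P * B).trace := by
      rw [← Matrix.mul_assoc, Matrix.trace_mul_comm, ← Matrix.mul_assoc]
    simp only [h, hsum_tr, Matrix.mul_smul, Matrix.trace_smul, Matrix.sub_mul, Matrix.mul_sub,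
      Matrix.smul_mul, Matrix.trace_sub, hPH, hcyc, smul_eq_mul]
    ring
  have hderiv : ∑ p, ∑ q, P p q * pd (S q i) p x
      = (1/2) * (P * A).trace
        - (1/2) * ∑ k, (∑ p, ∑ q, P p q * pd4 Φ p q i k x) * gradUp Φ k x
        + (1/2) * (P * A * P * B).trace := by
    rw [← hquartic, ← hsum_tr A, Matrix.mul_assoc, Matrix.mul_assoc, ← hsum_tr]
    simp only [Finset.mul_sum, ← Finset.sum_sub_distrib, ← Finset.sum_add_distrib]
    refine Finset.sum_congr rfl fun p _ => Finset.sum_congr rfl fun q _ => ?_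
    rw [hS, pd_covD1_pd hΩ hΦ hpos hx, Matrix.mul_assoc]
    simp only [Finset.mul_sum, mul_add, mul_sub, mul_left_comm, ← hP, ← hA, ← hB]
  simp only [covD2, mul_sub, Finset.sum_sub_distrib, hderiv, hfirst, hsecond]
  ring

theorem sum_mul_gradUp (F : Fin n → ℝ) :
    ∑ k, ∑ m, F k * ihess Φ x k m * pd Φ m x = ∑ k, F k * gradUp Φ k x := by
  simp only [gradUp, Finset.mul_sum, mul_assoc]

end HessianMetric

/-- the weighted tensor Laplacian of the (0,1)-tensor `T_i = Φ_i`. -/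
theorem stmt_6 {n : ℕ} (Ω : Set (Fin n → ℝ)) (hΩ : IsOpen Ω)
    (Φ V W : (Fin n → ℝ) → ℝ)
    (hΦ : ContDiffOn ℝ 5 Φ Ω) (hΦconv : ConvexOn ℝ Ω Φ)
    (hpos : ∀ x ∈ Ω, (hess Φ x).PosDef)
    (hV : ContDiffOn ℝ 3 V Ω) (hW : ContDiff ℝ 3 W)
    (hMA : ∀ x ∈ Ω, Real.exp (-V x) = Real.exp (-W (grad Φ x)) * (hess Φ x).det) :
    ∀ x ∈ Ω, ∀ i : Fin n,
      LT1 Φ V W (fun i => pd Φ i) i x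
      = (1/2) * (∑ k, ∑ m, (pd2 V i k x - What2 Φ W i k x) * ihess Φ x k m * pd Φ m x)
        + (1/4) * (∑ k, ∑ m, calabi Φ i k x * ihess Φ x k m * pd Φ m x)
        - (∑ m, Wop Φ W m x * pd2 Φ m i x) := by
  intro x hx i
  have hposx := hpos x hx
  set S := covD1 Φ (fun i => pd Φ i) with hS
  have hSsub : ∀ p, S p i x = pd2 Φ p i x - (1/2) * ∑ k, pd3 Φ p i k x * gradUp Φ k x := by
    intro p
    rw [hS, covD1_pd_eq hΩ hΦ hx, pd2_symm hΩ hΦ hx]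
  have hdrift : ∀ p, ∑ m, ihess Φ x p m * pd V m x
      = Wop Φ W p x - ∑ m, ihess Φ x p m * logDetDeriv Φ m x := by
    intro p
    have hw : ∀ m, ∑ a, Wop Φ W a x * pd2 Φ a m x
        = (hess Φ x *ᵥ fun a => Wop Φ W a x) m := fun m =>
      Finset.sum_congr rfl fun a _ => by
        rw [pd2_symm hΩ hΦ hx, mul_comm]
        rfl
    have hPw : ∑ m, ihess Φ x p m * (hess Φ x *ᵥ fun a => Wop Φ W a x) m = Wop Φ W p x := by
      change (ihess Φ x *ᵥ (hess Φ x *ᵥ fun a => Wop Φ W a x)) p = _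
      rw [Matrix.mulVec_mulVec, ihess_mul_hess hposx, Matrix.one_mulVec]
    simp only [pd_potential hΩ hΦ hpos hW hMA hx, hw, mul_sub, Finset.sum_sub_distrib, hPw]
  have hcal : ∑ k, calabi Φ i k x * gradUp Φ k x
      = (ihess Φ x * hessDeriv Φ i x * ihess Φ x * hessDerivGrad Φ x).trace := by
    simp only [calabi_eq_trace hΩ hΦ hx, sum_trace_mul_gradUp]
  have hV2 : ∑ k, (pd2 V i k x - What2 Φ W i k x) * gradUp Φ k x
      = ∑ a, Wop Φ W a x * ∑ k, pd3 Φ a i k x * gradUp Φ k x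
        + (ihess Φ x * hessDeriv Φ i x * ihess Φ x * hessDerivGrad Φ x).trace
        - ∑ k, (∑ p, ∑ q, ihess Φ x p q * pd4 Φ p q i k x) * gradUp Φ k x := by
    have hsum : ∑ a, Wop Φ W a x * ∑ k, pd3 Φ a i k x * gradUp Φ k x
        = ∑ k, (∑ a, Wop Φ W a x * pd3 Φ a i k x) * gradUp Φ k x := by
      simp only [Finset.mul_sum, Finset.sum_mul, mul_assoc]
      exact Finset.sum_comm
    rw [hsum, ← sum_trace_mul_gradUp, ← Finset.sum_add_distrib, ← Finset.sum_sub_distrib]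
    refine Finset.sum_congr rfl fun k _ => ?_
    have htr : (ihess Φ x * hessDeriv Φ k x * ihess Φ x * hessDeriv Φ i x).trace
        = (ihess Φ x * hessDeriv Φ i x * ihess Φ x * hessDeriv Φ k x).trace := by
      rw [Matrix.mul_assoc, Matrix.trace_mul_comm, ← Matrix.mul_assoc]
    rw [pd2_potential hΩ hΦ hpos hW hMA hx, htr]
    ring
  rw [sum_mul_gradUp, sum_mul_gradUp, hcal, hV2, LT1,
    sum_ihess_mul_covD2_covD1_pd hΩ hΦ hposx hx, ← hS]
  simp only [hdrift]
  have hsplit : ∑ p, (Wop Φ W p x - ∑ m, ihess Φ x p m * logDetDeriv Φ m x + Wop Φ W p x)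
        * S p i x
      = 2 * ∑ p, Wop Φ W p x * S p i x
        - ∑ p, (∑ m, ihess Φ x p m * logDetDeriv Φ m x) * S p i x := by
    rw [Finset.mul_sum, ← Finset.sum_sub_distrib]
    exact Finset.sum_congr rfl fun p _ => by ring
  have hWS : ∑ p, Wop Φ W p x * S p i x = ∑ m, Wop Φ W m x * pd2 Φ m i x
      - (1/2) * ∑ a, Wop Φ W a x * ∑ k, pd3 Φ a i k x * gradUp Φ k x := by
    rw [Finset.mul_sum, ← Finset.sum_sub_distrib]
    exact Finset.sum_congr rfl fun p _ => by rw [hSsub]; ring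
  rw [hsplit, hWS]
  ring
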